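/- arXiv:2509.02375 — 2 statements merged into one kernel-verified Lean document; each statement's English description precedes it below -/
import Mathlib

section
/- Let F be a field and n ≥ 1, and for p ∈ F[X] with deg p ≤ n define T(p) = Σ_{j=0}^{n} p.coeff(j) · X^{n−j}·(X²+1)^{j}. Then T gives a linear bijection from {p ∈ F[X] : deg p ≤ n} onto {r ∈ F[X] : deg r ≤ 2n and r.coeff(i) = r.coeff(2n−i) for all 0 ≤ i ≤ 2n}; that is, for every polynomial r of degree ≤ 2n satisfying r.coeff(i) = r.coeff(2n−i) for all 0 ≤ i ≤ 2n, there exists a unique p with deg p ≤ n and T(p) = r. -/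
open Polynomial

section PalindromicLift

variable {R : Type*} [CommRing R]

/-- The polynomial expression of `X ^ n * p (X + X⁻¹)`, where `p` has coefficients `c`. -/
noncomputable def palindromicLift (n : ℕ) (c : ℕ → R) : R[X] :=
  ∑ j ∈ Finset.range (n + 1), C (c j) * X ^ (n - j) * (X ^ 2 + 1) ^ j

/-- Polynomials of degree at most `N` whose coefficient list of length `N + 1` is a palindrome. -/
def palindromicSubmodule (R : Type*) [CommRing R] (N : ℕ) : Submodule R R[X] where
  carrier := {r | r.natDegree ≤ N ∧ r.reflect N = r}
  add_mem' hp hq := ⟨natDegree_add_le_of_degree_le hp.1 hq.1, by rw [reflect_add, hp.2, hq.2]⟩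
  zero_mem' := ⟨by simp, reflect_zero⟩
  smul_mem' a p hp := ⟨(natDegree_smul_le a p).trans hp.1, by
    rw [smul_eq_C_mul, reflect_C_mul, hp.2]⟩

theorem mem_palindromicSubmodule_iff {N : ℕ} {r : R[X]} :
    r ∈ palindromicSubmodule R N ↔
      r.degree ≤ N ∧ ∀ i ≤ N, r.coeff i = r.coeff (N - i) := by
  rw [← natDegree_le_iff_degree_le]
  refine and_congr_right fun _ => ⟨fun h i hi => ?_, fun h => ?_⟩
  · rw [← revAt_le hi, ← coeff_reflect, h]
  · ext i
    rw [coeff_reflect]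
    rcases le_or_gt i N with hi | hi
    · rw [revAt_le hi, h i hi]
    · rw [revAt_eq_self_of_lt hi]

theorem mul_mem_palindromicSubmodule {M N : ℕ} {p q : R[X]}
    (hp : p ∈ palindromicSubmodule R M) (hq : q ∈ palindromicSubmodule R N) :
    p * q ∈ palindromicSubmodule R (M + N) :=
  ⟨natDegree_mul_le_of_le hp.1 hq.1, by rw [reflect_mul p q hp.1 hq.1, hp.2, hq.2]⟩

theorem one_mem_palindromicSubmodule : (1 : R[X]) ∈ palindromicSubmodule R 0 :=
  ⟨by simp, by simp [reflect_one]⟩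

theorem X_mem_palindromicSubmodule : (X : R[X]) ∈ palindromicSubmodule R 2 :=
  ⟨natDegree_X_le.trans one_le_two, by simpa using reflect_monomial (R := R) 2 1⟩

theorem X_sq_add_one_mem_palindromicSubmodule :
    (X ^ 2 + 1 : R[X]) ∈ palindromicSubmodule R 2 := by
  refine ⟨by compute_degree, ?_⟩
  rw [reflect_add, reflect_one, reflect_monomial, revAt_le le_rfl]
  simp [add_comm]

theorem pow_mem_palindromicSubmodule {N : ℕ} {p : R[X]}
    (hp : p ∈ palindromicSubmodule R N) (k : ℕ) :
    p ^ k ∈ palindromicSubmodule R (N * k) := by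
  induction k with
  | zero => simpa using one_mem_palindromicSubmodule
  | succ k ih => simpa [pow_succ, mul_add] using mul_mem_palindromicSubmodule ih hp

theorem palindromicLift_mem (n : ℕ) (c : ℕ → R) :
    palindromicLift n c ∈ palindromicSubmodule R (2 * n) := by
  refine Submodule.sum_mem _ fun j hj => ?_
  have hj' : j ≤ n := Finset.mem_range_succ_iff.mp hj
  have h := mul_mem_palindromicSubmodule
    (pow_mem_palindromicSubmodule (X_mem_palindromicSubmodule (R := R)) (n - j))
    (pow_mem_palindromicSubmodule X_sq_add_one_mem_palindromicSubmodule j)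
  rw [← mul_add, Nat.sub_add_cancel hj'] at h
  rw [mul_assoc, ← smul_eq_C_mul]
  exact Submodule.smul_mem _ _ h

theorem palindromicLift_zero (c : ℕ → R) : palindromicLift 0 c = C (c 0) := by
  simp [palindromicLift]

theorem palindromicLift_succ (n : ℕ) (c : ℕ → R) :
    palindromicLift (n + 1) c =
      X * palindromicLift n c + C (c (n + 1)) * (X ^ 2 + 1) ^ (n + 1) := by
  rw [palindromicLift, Finset.sum_range_succ, palindromicLift, Finset.mul_sum]
  congr 1
  · refine Finset.sum_congr rfl fun j hj => ?_
    rw [Nat.succ_sub (Finset.mem_range_succ_iff.mp hj), pow_succ]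
    ring
  · simp

theorem palindromicLift_congr {n : ℕ} {c d : ℕ → R} (h : ∀ j ≤ n, c j = d j) :
    palindromicLift n c = palindromicLift n d :=
  Finset.sum_congr rfl fun j hj => by rw [h j (Finset.mem_range_succ_iff.mp hj)]

theorem coeff_zero_palindromicLift (n : ℕ) (c : ℕ → R) :
    (palindromicLift n c).coeff 0 = c n := by
  cases n with
  | zero => simp [palindromicLift_zero]
  | succ n => simp [palindromicLift_succ, coeff_zero_eq_eval_zero]

theorem eq_of_palindromicLift_eq {n : ℕ} {c d : ℕ → R}
    (h : palindromicLift n c = palindromicLift n d) : ∀ j ≤ n, c j = d j := by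
  have top (m : ℕ) (h : palindromicLift m c = palindromicLift m d) : c m = d m := by
    rw [← coeff_zero_palindromicLift m c, h, coeff_zero_palindromicLift]
  induction n with
  | zero => intro j hj; rw [Nat.le_zero.mp hj]; exact top 0 h
  | succ n ih =>
    intro j hj
    rcases Nat.le_succ_iff.mp hj with hj | rfl
    · have htop := top _ h
      rw [palindromicLift_succ, palindromicLift_succ, htop, add_left_inj] at h
      exact ih (isRegular_X.left h) j hj
    · exact top _ h

theorem divX_mem_palindromicSubmodule {N : ℕ} {r : R[X]}
    (hr : r ∈ palindromicSubmodule R (N + 2)) (h0 : r.coeff 0 = 0) :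
    r.divX ∈ palindromicSubmodule R N := by
  rw [mem_palindromicSubmodule_iff, ← natDegree_le_iff_degree_le] at hr ⊢
  obtain ⟨hdeg, hpal⟩ := hr
  refine ⟨natDegree_le_iff_coeff_eq_zero.mpr fun k hk => ?_, fun i hi => ?_⟩
  · rw [coeff_divX]
    rcases Nat.eq_or_lt_of_le (Nat.succ_le_of_lt hk) with rfl | hk
    · rw [hpal _ le_rfl, Nat.sub_self, h0]
    · exact coeff_eq_zero_of_natDegree_lt (by omega)
  · rw [coeff_divX, coeff_divX, hpal _ (by omega)]
    congr 1
    omega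

theorem exists_palindromicLift_eq {n : ℕ} {r : R[X]}
    (hr : r ∈ palindromicSubmodule R (2 * n)) : ∃ c : ℕ → R, palindromicLift n c = r := by
  induction n generalizing r with
  | zero =>
    exact ⟨r.coeff, by rw [palindromicLift_zero, ← eq_C_of_natDegree_le_zero hr.1]⟩
  | succ n ih =>
    set s := r - C (r.coeff 0) * (X ^ 2 + 1) ^ (n + 1) with hs
    have hs_mem : s ∈ palindromicSubmodule R (2 * n + 2) := by
      rw [hs, ← smul_eq_C_mul]
      exact Submodule.sub_mem _ hr (Submodule.smul_mem _ _
        (pow_mem_palindromicSubmodule X_sq_add_one_mem_palindromicSubmodule (n + 1)))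
    have hs0 : s.coeff 0 = 0 := by simp [hs, coeff_zero_eq_eval_zero]
    obtain ⟨c, hc⟩ := ih (divX_mem_palindromicSubmodule hs_mem hs0)
    refine ⟨Function.update c (n + 1) (r.coeff 0), ?_⟩
    rw [palindromicLift_succ, Function.update_self,
      palindromicLift_congr fun j hj => Function.update_of_ne (by omega) _ c, hc]
    have hX := X_mul_divX_add s
    rw [hs0, C_0, add_zero] at hX
    rw [hX, hs, sub_add_cancel]

end PalindromicLift

/-- Lemma 2.6 of the paper (the isomorphism `T : Vₙ → W₂ₙ`): the linear map
`T(p) = ∑_{j=0}^{n} p.coeff j • X^(n-j) (X²+1)^j` sends polynomials of degree ≤ n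
into palindromic polynomials of degree ≤ 2n, and every palindromic polynomial `r` of
degree ≤ 2n has a unique preimage `p` of degree ≤ n with `T(p) = r`. -/
theorem T_bijection_onto_palindromic (F : Type*) [Field F] (n : ℕ) (hn : 1 ≤ n) :
    (∀ p : Polynomial F, p.degree ≤ n →
      (∑ j ∈ Finset.range (n + 1),
          Polynomial.C (p.coeff j) * X ^ (n - j) * (X ^ 2 + 1) ^ j).degree ≤ ((2 * n : ℕ) : WithBot ℕ) ∧
      ∀ i ≤ 2 * n,
        (∑ j ∈ Finset.range (n + 1),
            Polynomial.C (p.coeff j) * X ^ (n - j) * (X ^ 2 + 1) ^ j).coeff i =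
        (∑ j ∈ Finset.range (n + 1),
            Polynomial.C (p.coeff j) * X ^ (n - j) * (X ^ 2 + 1) ^ j).coeff (2 * n - i)) ∧
    (∀ r : Polynomial F, r.degree ≤ (2 * n : ℕ) →
      (∀ i ≤ 2 * n, r.coeff i = r.coeff (2 * n - i)) →
      ∃! p : Polynomial F, p.degree ≤ n ∧
        ∑ j ∈ Finset.range (n + 1),
          Polynomial.C (p.coeff j) * X ^ (n - j) * (X ^ 2 + 1) ^ j = r) := by
  refine ⟨fun p _ => mem_palindromicSubmodule_iff.mp (palindromicLift_mem n p.coeff),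
    fun r hdeg hpal => ?_⟩
  obtain ⟨c, hc⟩ := exists_palindromicLift_eq (mem_palindromicSubmodule_iff.mpr ⟨hdeg, hpal⟩)
  have hcoeff (j : ℕ) (hj : j ≤ n) :
      (∑ k ∈ Finset.range (n + 1), monomial k (c k)).coeff j = c j := by
    simp [coeff_monomial, Nat.lt_succ_of_le hj]
  refine ⟨∑ k ∈ Finset.range (n + 1), monomial k (c k),
    ⟨?_, (palindromicLift_congr hcoeff).trans hc⟩, ?_⟩
  · refine (degree_sum_le _ _).trans (Finset.sup_le fun k hk => ?_)
    exact (degree_monomial_le _ _).trans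
      (by exact_mod_cast Finset.mem_range_succ_iff.mp hk)
  · rintro q ⟨hq, hqr⟩
    ext j
    rcases le_or_gt j n with hj | hj
    · rw [hcoeff j hj]
      exact eq_of_palindromicLift_eq (hqr.trans hc.symm) j hj
    · rw [coeff_eq_zero_of_degree_lt (hq.trans_lt (by exact_mod_cast hj)), finsetSum_coeff]
      refine (Finset.sum_eq_zero fun k hk => coeff_monomial_of_ne _ ?_).symm
      have := Finset.mem_range_succ_iff.mp hk
      omega
end

section
/- Let F be a field, n ≥ 1, and p ∈ F[X] with deg p ≤ n. Then there exists q ∈ F[X] with deg q ≤ n and p(X²) = Σ_{j=0}^{n} q.coeff(j)·X^{n−j}·(X²+1)^{j} (i.e., p is represented by q) if and only if p.coeff(i) = p.coeff(n−i) for all 0 ≤ i ≤ n. Moreover, in this case the representing polynomial q is unique and satisfies q.coeff(n−i) = 0 for all odd i with 0 ≤ i ≤ n. -/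
open Polynomial

theorem reflect_X_sq_add_one_pow {R : Type*} [CommSemiring R] (j : ℕ) :
    reflect (2 * j) ((X ^ 2 + 1 : R[X]) ^ j) = (X ^ 2 + 1) ^ j := by
  have hdeg : (X ^ 2 + 1 : R[X]).natDegree ≤ 2 := by compute_degree
  have hbase : reflect 2 (X ^ 2 + 1 : R[X]) = X ^ 2 + 1 := by
    have h := reflect_monomial (R := R) 2 2
    have h0 := reflect_monomial (R := R) 2 0
    rw [revAt_le le_rfl] at h
    rw [revAt_le (Nat.zero_le 2)] at h0
    simp only [pow_zero, Nat.sub_self, Nat.sub_zero] at h h0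
    rw [reflect_add, h, h0, add_comm]
  induction j with
  | zero => simp
  | succ j ih =>
    rw [pow_succ, mul_add_one, reflect_mul _ _ _ hdeg, ih, hbase]
    exact (natDegree_pow_le_of_le j hdeg).trans_eq (mul_comm _ _)

theorem reflect_sum_X_pow_mul_X_sq_add_one_pow {R : Type*} [CommSemiring R] (n : ℕ) (a : ℕ → R) :
    reflect (2 * n)
        (∑ j ∈ Finset.range (n + 1), C (a j) * X ^ (n - j) * (X ^ 2 + 1 : R[X]) ^ j) =
      ∑ j ∈ Finset.range (n + 1), C (a j) * X ^ (n - j) * (X ^ 2 + 1) ^ j := by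
  have hdeg : (X ^ 2 + 1 : R[X]).natDegree ≤ 2 := by compute_degree
  have hsum := map_sum (⟨⟨reflect (2 * n), reflect_zero⟩, fun f g => reflect_add f g _⟩ :
    R[X] →+ R[X]) (fun j => C (a j) * X ^ (n - j) * (X ^ 2 + 1 : R[X]) ^ j)
    (Finset.range (n + 1))
  refine hsum.trans (Finset.sum_congr rfl fun j hj => ?_)
  have hjn : j ≤ n := Finset.mem_range_succ_iff.mp hj
  change reflect (2 * n) (C (a j) * X ^ (n - j) * (X ^ 2 + 1) ^ j) = _
  rw [show 2 * n = 2 * (n - j) + 2 * j by lia, reflect_mul, reflect_X_sq_add_one_pow,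
    reflect_C_mul_X_pow, revAt_le (by lia), show 2 * (n - j) - (n - j) = n - j by lia]
  · exact (natDegree_C_mul_X_pow_le _ _).trans (by lia)
  · exact (natDegree_pow_le_of_le j hdeg).trans_eq (mul_comm _ _)

theorem coeff_eq_coeff_sub_of_comp_X_sq_eq_sum {R : Type*} [CommSemiring R] {n : ℕ} {p : R[X]}
    {a : ℕ → R}
    (h : p.comp (X ^ 2) =
      ∑ j ∈ Finset.range (n + 1), C (a j) * X ^ (n - j) * (X ^ 2 + 1) ^ j)
    {i : ℕ} (hi : i ≤ n) : p.coeff i = p.coeff (n - i) := by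
  have hreflect := reflect_sum_X_pow_mul_X_sq_add_one_pow n a
  rw [← h, ← expand_eq_comp_X_pow] at hreflect
  have hcoeff := congrArg (fun f => coeff f (2 * i)) hreflect
  simp only [coeff_reflect] at hcoeff
  rw [revAt_le (by lia), ← Nat.mul_sub, coeff_expand_mul' two_pos,
    coeff_expand_mul' two_pos] at hcoeff
  exact hcoeff.symm

theorem sum_X_pow_mul_X_sq_add_one_pow_succ {R : Type*} [CommSemiring R] (n : ℕ) (a : ℕ → R) :
    ∑ j ∈ Finset.range (n + 2), C (a j) * X ^ (n + 1 - j) * (X ^ 2 + 1 : R[X]) ^ j =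
      X * ∑ j ∈ Finset.range (n + 1), C (a j) * X ^ (n - j) * (X ^ 2 + 1) ^ j +
        C (a (n + 1)) * (X ^ 2 + 1) ^ (n + 1) := by
  rw [Finset.sum_range_succ, Finset.mul_sum, Nat.sub_self, pow_zero, mul_one]
  congr 1
  refine Finset.sum_congr rfl fun j hj => ?_
  rw [Nat.sub_add_comm (Finset.mem_range_succ_iff.mp hj)]
  ring

theorem eq_zero_of_sum_X_pow_mul_X_sq_add_one_pow_eq_zero {R : Type*} [CommSemiring R] {n : ℕ}
    {a : ℕ → R}
    (h : ∑ j ∈ Finset.range (n + 1), C (a j) * X ^ (n - j) * (X ^ 2 + 1 : R[X]) ^ j = 0)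
    {j : ℕ} (hj : j ≤ n) : a j = 0 := by
  induction n with
  | zero => simpa [Nat.le_zero.mp hj] using h
  | succ n ih =>
    rw [sum_X_pow_mul_X_sq_add_one_pow_succ] at h
    have htop : a (n + 1) = 0 := by simpa [coeff_zero_eq_eval_zero] using congrArg (eval 0) h
    rcases hj.eq_or_lt with rfl | hj
    · exact htop
    · refine ih ?_ (Nat.lt_succ_iff.mp hj)
      ext k
      simpa [htop] using congrArg (fun f => coeff f (k + 1)) h

theorem coeff_eq_of_sum_X_pow_mul_X_sq_add_one_pow_eq {R : Type*} [CommRing R] {n : ℕ}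
    {a b : ℕ → R}
    (h : ∑ j ∈ Finset.range (n + 1), C (a j) * X ^ (n - j) * (X ^ 2 + 1 : R[X]) ^ j =
      ∑ j ∈ Finset.range (n + 1), C (b j) * X ^ (n - j) * (X ^ 2 + 1) ^ j)
    {j : ℕ} (hj : j ≤ n) : a j = b j := by
  refine sub_eq_zero.mp (eq_zero_of_sum_X_pow_mul_X_sq_add_one_pow_eq_zero
    (a := fun j => a j - b j) ?_ hj)
  simpa [sub_mul, Finset.sum_sub_distrib] using sub_eq_zero.mpr h

theorem exists_comp_X_sq_eq_sum_of_palindromic {R : Type*} [CommRing R] (n : ℕ) (p : R[X])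
    (hp : ∀ i, n < i → p.coeff i = 0) (hpal : ∀ i ≤ n, p.coeff i = p.coeff (n - i)) :
    ∃ a : ℕ → R,
      p.comp (X ^ 2) =
        ∑ j ∈ Finset.range (n + 1), C (a j) * X ^ (n - j) * (X ^ 2 + 1) ^ j ∧
      ∀ i ≤ n, Odd i → a (n - i) = 0 := by
  induction n using Nat.twoStepInduction generalizing p with
  | zero =>
    have hC : p = C (p.coeff 0) := by
      ext (_ | k)
      · simp
      · simp [hp (k + 1)]
    refine ⟨fun _ => p.coeff 0, ?_, ?_⟩
    · rw [hC]
      simp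
    · rintro i hi ⟨k, rfl⟩
      lia
  | one =>
    have hlin : p = C (p.coeff 0) * (X + 1) := by
      ext (_ | _ | k)
      · simp
      · simp [mul_add, hpal 0, coeff_C]
      · simp [mul_add, hp (k + 2)]
    refine ⟨fun j => if j = 1 then p.coeff 0 else 0, ?_, ?_⟩
    · rw [hlin]
      simp [Finset.sum_range_succ]
    · rintro i hi ⟨k, rfl⟩
      simp
  | more m ih _ =>
    set r : R[X] := p - C (p.coeff 0) * (X + 1) ^ (m + 2) with hr
    have hrc (i : ℕ) : r.coeff i = p.coeff i - p.coeff 0 * ((m + 2).choose i : R) := by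
      rw [hr, coeff_sub, coeff_C_mul, coeff_X_add_one_pow]
    have hrpal (i : ℕ) (hi : i ≤ m + 2) : r.coeff i = r.coeff (m + 2 - i) := by
      rw [hrc, hrc, Nat.choose_symm hi, hpal i hi]
    have hr0 : r.coeff 0 = 0 := by simp [hrc]
    have hrX : X * r.divX = r := by simpa [hr0] using X_mul_divX_add r
    obtain ⟨a, ha, hodd⟩ := ih r.divX
      (fun i hi => by
        rw [coeff_divX]
        rcases (show m + 1 ≤ i from hi).eq_or_lt with rfl | hi
        · rw [hrpal _ le_rfl, Nat.sub_self, hr0]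
        · rw [hrc, hp _ (by lia), Nat.choose_eq_zero_of_lt (by lia)]
          simp)
      (fun i hi => by
        rw [coeff_divX, coeff_divX, hrpal _ (by lia)]
        congr 1
        lia)
    refine ⟨fun j => if j ≤ m then a j else if j = m + 2 then p.coeff 0 else 0, ?_, ?_⟩
    · have hp_eq : p = X * r.divX + C (p.coeff 0) * (X + 1) ^ (m + 2) := by
        rw [hrX, hr, sub_add_cancel]
      have hcomp := congrArg (fun f => f.comp (X ^ 2 : R[X])) hp_eq
      simp only [add_comp, mul_comp, X_comp, C_comp, pow_comp, one_comp, ha] at hcomp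
      rw [hcomp, sum_X_pow_mul_X_sq_add_one_pow_succ, sum_X_pow_mul_X_sq_add_one_pow_succ]
      have hsum : ∑ j ∈ Finset.range (m + 1),
          C (if j ≤ m then a j else if j = m + 2 then p.coeff 0 else 0) * X ^ (m - j) *
            (X ^ 2 + 1 : R[X]) ^ j =
          ∑ j ∈ Finset.range (m + 1), C (a j) * X ^ (m - j) * (X ^ 2 + 1) ^ j :=
        Finset.sum_congr rfl fun j hj => by rw [if_pos (Finset.mem_range_succ_iff.mp hj)]
      rw [hsum]
      simp
      ring
    · intro i hi hi_odd
      rcases i with _ | _ | i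
      · simp at hi_odd
      · simp
      · have h := hodd i (by lia) (by grind)
        simpa [show m + 2 - (i + 1 + 1) = m - i by lia] using h

/-- Proposition 2.7 of the paper: a polynomial `p` of degree ≤ n is represented by some
`q` of degree ≤ n (i.e. `p(X²) = Xⁿ q(X + X⁻¹)`) iff `p` is palindromic; moreover the
representing polynomial `q` is unique and lies in `Uₙ` (its coefficients
`q.coeff (n - i)` vanish for all odd `i`). -/
theorem representable_iff_palindromic (F : Type*) [Field F] (n : ℕ) (hn : 1 ≤ n)
    (p : Polynomial F) (hp : p.degree ≤ n) :
    ((∃ q : Polynomial F, q.degree ≤ n ∧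
        p.comp (X ^ 2) =
          ∑ j ∈ Finset.range (n + 1),
            Polynomial.C (q.coeff j) * X ^ (n - j) * (X ^ 2 + 1) ^ j) ↔
      (∀ i ≤ n, p.coeff i = p.coeff (n - i))) ∧
    (∀ q q' : Polynomial F, q.degree ≤ n → q'.degree ≤ n →
      p.comp (X ^ 2) =
        ∑ j ∈ Finset.range (n + 1),
          Polynomial.C (q.coeff j) * X ^ (n - j) * (X ^ 2 + 1) ^ j →
      p.comp (X ^ 2) =
        ∑ j ∈ Finset.range (n + 1),
          Polynomial.C (q'.coeff j) * X ^ (n - j) * (X ^ 2 + 1) ^ j →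
      q = q') ∧
    (∀ q : Polynomial F, q.degree ≤ n →
      p.comp (X ^ 2) =
        ∑ j ∈ Finset.range (n + 1),
          Polynomial.C (q.coeff j) * X ^ (n - j) * (X ^ 2 + 1) ^ j →
      ∀ i ≤ n, Odd i → q.coeff (n - i) = 0) := by
  have hp' (i : ℕ) (hi : n < i) : p.coeff i = 0 :=
    coeff_eq_zero_of_degree_lt (hp.trans_lt (by exact_mod_cast hi))
  refine ⟨⟨?_, fun hpal => ?_⟩, fun q q' hq hq' h h' => ?_, fun q _ h i hi hodd => ?_⟩
  · rintro ⟨q, -, h⟩ i hi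
    exact coeff_eq_coeff_sub_of_comp_X_sq_eq_sum h hi
  · obtain ⟨a, ha, -⟩ := exists_comp_X_sq_eq_sum_of_palindromic n p hp' hpal
    have hcoeff (j : ℕ) :
        (∑ i ∈ Finset.range (n + 1), monomial i (a i)).coeff j = if j ≤ n then a j else 0 := by
      simp [coeff_monomial]
    refine ⟨∑ i ∈ Finset.range (n + 1), monomial i (a i), ?_, ?_⟩
    · refine degree_le_iff_coeff_zero _ _ |>.mpr fun j hj => ?_
      rw [hcoeff, if_neg (not_le.mpr (by exact_mod_cast hj))]
    · refine ha.trans (Finset.sum_congr rfl fun j hj => ?_)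
      rw [hcoeff, if_pos (Finset.mem_range_succ_iff.mp hj)]
  · ext j
    rcases le_or_gt j n with hj | hj
    · exact coeff_eq_of_sum_X_pow_mul_X_sq_add_one_pow_eq (h.symm.trans h') hj
    · have hj' : (n : WithBot ℕ) < j := by exact_mod_cast hj
      rw [coeff_eq_zero_of_degree_lt (hq.trans_lt hj'),
        coeff_eq_zero_of_degree_lt (hq'.trans_lt hj')]
  · obtain ⟨a, ha, ha_odd⟩ := exists_comp_X_sq_eq_sum_of_palindromic n p hp'
      fun i hi => coeff_eq_coeff_sub_of_comp_X_sq_eq_sum h hi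
    rw [coeff_eq_of_sum_X_pow_mul_X_sq_add_one_pow_eq (h.symm.trans ha) (Nat.sub_le n i)]
    exact ha_odd i hi hodd
end
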